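/- Let v₁, u₀ ∈ ℝ be such that the ray {(u, v₁) : u ≤ u₀} is contained in U, write r₀(u) := r(u, v₁), and assume r₀(u) → ∞ as u → −∞. Let α : U → ℝ be a smooth fixed-mode solution of the spin-s Teukolsky equation. Suppose there are constants A ∈ ℝ, C ≥ 0, ε > 0 and a real number p with p > max(−s−1, −1/2) such that |α(u, v₁) − A·r₀(u)^(s−p)| ≤ C·r₀(u)^(s−p−ε) for all u ≤ u₀, and suppose that for every integer n ≥ 1 one has r₀(u)^(−2s)·(∂ᵥⁿα)(u, v₁) → 0 as u → −∞. Then for every integer N with 0 ≤ N ≤ ℓ−s there exists a constant C′ ≥ 0 such that for all u ≤ u₀: | ( ((r²/D)∂ᵥ)^N α )(u, v₁) − A·c_N·r₀(u)^(N+s−p) | ≤ C′·( r₀(u)^(N+s−p−ε) + M·r₀(u)^(N+s−p−1) ), where c_N := ( Γ(s+p+1)/Γ(N+s+p+1) ) · (−1)^N · ( (ℓ−s)!·(N+s+ℓ)! ) / ( (ℓ−s−N)!·(ℓ+s)! ). (Fixed-angular-mode form of Proposition 9.4 on transversal derivatives along the initial ingoing cone.) -/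

import Mathlib

open scoped ContDiff

noncomputable section

/-- Partial derivative with respect to the first (`u`) null coordinate. -/
def pdu (f : ℝ × ℝ → ℝ) : ℝ × ℝ → ℝ := fun p => deriv (fun x => f (x, p.2)) p.1

/-- Partial derivative with respect to the second (`v`) null coordinate. -/
def pdv (f : ℝ × ℝ → ℝ) : ℝ × ℝ → ℝ := fun p => deriv (fun y => f (p.1, y)) p.2

/-- `D = 1 - 2M/r`. -/
def Dfun (M : ℝ) (r : ℝ × ℝ → ℝ) : ℝ × ℝ → ℝ := fun p => 1 - 2 * M / r p

/-- The weighted transversal derivative operator `(r²/D)∂ᵥ`. -/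
def Pv (M : ℝ) (r f : ℝ × ℝ → ℝ) : ℝ × ℝ → ℝ := fun p => (r p) ^ 2 / Dfun M r p * pdv f p

/-- Factorial of a (nonnegative) integer, as a real number. -/
def zfactR (n : ℤ) : ℝ := (Nat.factorial n.toNat : ℝ)

/-- `α` is a fixed-mode solution of the spin-`s` Teukolsky equation (Teuk:s) on `U`,
projected to spherical-harmonic number `ℓ`, i.e.
`∂ᵤ(r^(−2s) D^s ∂ᵥα) = D^(s+1) r^(−2−2s) Λ α − 2M D^(s+1) r^(−3−2s) (1+s)(1+2s) α`
with `Λ = −(ℓ−s)(ℓ+s+1)`. -/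
def TeukSol (M : ℝ) (r : ℝ × ℝ → ℝ) (U : Set (ℝ × ℝ)) (s ℓ : ℤ) (α : ℝ × ℝ → ℝ) : Prop :=
  ∀ p ∈ U,
    pdu (fun q => (r q) ^ (-(2 * s)) * (Dfun M r q) ^ s * pdv α q) p =
      (Dfun M r p) ^ (s + 1) * (r p) ^ (-2 - 2 * s) * ((-(ℓ - s) * (ℓ + s + 1) : ℤ) : ℝ) * α p
        - 2 * M * (Dfun M r p) ^ (s + 1) * (r p) ^ (-3 - 2 * s) *
          (((1 + s) * (1 + 2 * s) : ℤ) : ℝ) * α p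

open Filter Topology Set

section NullDerivatives

variable {U : Set (ℝ × ℝ)} {f g : ℝ × ℝ → ℝ} {p : ℝ × ℝ}

lemma DifferentiableAt.hasDerivAt_snd_slice (hf : DifferentiableAt ℝ f p) :
    HasDerivAt (fun y => f (p.1, y)) (fderiv ℝ f p (0, 1)) p.2 :=
  HasFDerivAt.comp_hasDerivAt (f := fun y : ℝ => (p.1, y)) p.2 hf.hasFDerivAt
    ((hasDerivAt_const p.2 p.1).prodMk (hasDerivAt_id p.2))

lemma DifferentiableAt.hasDerivAt_fst_slice (hf : DifferentiableAt ℝ f p) :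
    HasDerivAt (fun x => f (x, p.2)) (fderiv ℝ f p (1, 0)) p.1 :=
  HasFDerivAt.comp_hasDerivAt (f := fun x : ℝ => (x, p.2)) p.1 hf.hasFDerivAt
    ((hasDerivAt_id p.1).prodMk (hasDerivAt_const p.1 p.2))

lemma DifferentiableAt.pdv_eq (hf : DifferentiableAt ℝ f p) : pdv f p = fderiv ℝ f p (0, 1) :=
  hf.hasDerivAt_snd_slice.deriv

lemma DifferentiableAt.pdu_eq (hf : DifferentiableAt ℝ f p) : pdu f p = fderiv ℝ f p (1, 0) :=
  hf.hasDerivAt_fst_slice.deriv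

lemma ContDiffOn.differentiableAt_of_isOpen (hf : ContDiffOn ℝ ∞ f U) (hU : IsOpen U)
    (hp : p ∈ U) : DifferentiableAt ℝ f p :=
  (hf.contDiffAt (hU.mem_nhds hp)).differentiableAt (by simp)

lemma ContDiffOn.hasDerivAt_pdv (hf : ContDiffOn ℝ ∞ f U) (hU : IsOpen U) (hp : p ∈ U) :
    HasDerivAt (fun y => f (p.1, y)) (pdv f p) p.2 := by
  have h := hf.differentiableAt_of_isOpen hU hp
  exact h.pdv_eq ▸ h.hasDerivAt_snd_slice

lemma ContDiffOn.hasDerivAt_pdu (hf : ContDiffOn ℝ ∞ f U) (hU : IsOpen U) (hp : p ∈ U) :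
    HasDerivAt (fun x => f (x, p.2)) (pdu f p) p.1 := by
  have h := hf.differentiableAt_of_isOpen hU hp
  exact h.pdu_eq ▸ h.hasDerivAt_fst_slice

lemma ContDiffOn.pdv (hf : ContDiffOn ℝ ∞ f U) (hU : IsOpen U) : ContDiffOn ℝ ∞ (pdv f) U :=
  ((hf.fderiv_of_isOpen hU (m := ∞) (by simp)).clm_apply contDiffOn_const).congr
    fun _ hq => (hf.differentiableAt_of_isOpen hU hq).pdv_eq

lemma ContDiffOn.pdu (hf : ContDiffOn ℝ ∞ f U) (hU : IsOpen U) : ContDiffOn ℝ ∞ (pdu f) U :=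
  ((hf.fderiv_of_isOpen hU (m := ∞) (by simp)).clm_apply contDiffOn_const).congr
    fun _ hq => (hf.differentiableAt_of_isOpen hU hq).pdu_eq

lemma eventually_snd_slice_mem (hU : IsOpen U) (hp : p ∈ U) : ∀ᶠ y in 𝓝 p.2, (p.1, y) ∈ U :=
  (Continuous.prodMk_right p.1).continuousAt.eventually_mem (hU.mem_nhds hp)

lemma pdv_congr (hU : IsOpen U) (hfg : EqOn f g U) (hp : p ∈ U) : pdv f p = pdv g p :=
  Filter.EventuallyEq.deriv_eq <| (eventually_snd_slice_mem hU hp).mono fun _ hy => hfg hy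

lemma pdu_pdv_comm (hU : IsOpen U) (hf : ContDiffOn ℝ ∞ f U) (hp : p ∈ U) :
    pdu (pdv f) p = pdv (pdu f) p := by
  have hd : DifferentiableAt ℝ (fderiv ℝ f) p :=
    ((hf.fderiv_of_isOpen hU (m := ∞) (by simp)).contDiffAt (hU.mem_nhds hp)).differentiableAt
      (by simp)
  have key : ∀ w : ℝ × ℝ, fderiv ℝ (fun q => fderiv ℝ f q w) p
      = (fderiv ℝ (fderiv ℝ f) p).flip w := fun w => by
    rw [fderiv_clm_apply hd (differentiableAt_const w)]
    simp
  have hsymm : IsSymmSndFDerivAt ℝ f p :=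
    (hf.contDiffAt (hU.mem_nhds hp)).isSymmSndFDerivAt
      (by simp only [minSmoothness_of_isRCLikeNormedField]; exact WithTop.coe_le_coe.2 le_top)
  have ev : (pdv f) =ᶠ[𝓝 p] fun q => fderiv ℝ f q (0, 1) :=
    (hU.eventually_mem hp).mono fun q hq => (hf.differentiableAt_of_isOpen hU hq).pdv_eq
  have eu : (pdu f) =ᶠ[𝓝 p] fun q => fderiv ℝ f q (1, 0) :=
    (hU.eventually_mem hp).mono fun q hq => (hf.differentiableAt_of_isOpen hU hq).pdu_eq
  rw [((hf.pdv hU).differentiableAt_of_isOpen hU hp).pdu_eq,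
    ((hf.pdu hU).differentiableAt_of_isOpen hU hp).pdv_eq, ev.fderiv_eq, eu.fderiv_eq, key, key]
  exact hsymm _ _

end NullDerivatives

section TransportEstimate

lemma abs_le_of_abs_deriv_le_of_tendsto_atBot {F F' G G' : ℝ → ℝ} {u₀ : ℝ}
    (hF : ∀ u ≤ u₀, HasDerivAt F (F' u) u) (hG : ∀ u ≤ u₀, HasDerivAt G (G' u) u)
    (hle : ∀ u ≤ u₀, |F' u| ≤ G' u) (hF0 : Tendsto F atBot (𝓝 0)) (hG0 : Tendsto G atBot (𝓝 0))
    {u : ℝ} (hu : u ≤ u₀) : |F u| ≤ G u := by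
  have nonneg : ∀ H H' : ℝ → ℝ, (∀ x ≤ u₀, HasDerivAt H (H' x) x) → (∀ x ≤ u₀, 0 ≤ H' x) →
      Tendsto H atBot (𝓝 0) → 0 ≤ H u := by
    intro H H' hH hpos h0
    have hmono : MonotoneOn H (Iic u₀) := by
      refine monotoneOn_of_deriv_nonneg (convex_Iic u₀)
        (fun x hx => (hH x hx).continuousAt.continuousWithinAt)
        (fun x hx => (hH x (mem_Iic.1 (interior_subset hx))).differentiableAt.differentiableWithinAt)
        fun x hx => ?_
      rw [(hH x (mem_Iic.1 (interior_subset hx))).deriv]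
      exact hpos x (mem_Iic.1 (interior_subset hx))
    exact le_of_tendsto h0 ((eventually_le_atBot u).mono fun x hx => hmono (hx.trans hu) hu hx)
  have h₁ := nonneg _ _ (fun x hx => (hG x hx).sub (hF x hx))
    (fun x hx => sub_nonneg.2 ((le_abs_self _).trans (hle x hx))) (by simpa using! hG0.sub hF0)
  have h₂ := nonneg _ _ (fun x hx => (hG x hx).add (hF x hx))
    (fun x hx => by linarith [neg_abs_le (F' x), hle x hx]) (by simpa using! hG0.add hF0)
  simp only [Pi.sub_apply, Pi.add_apply] at h₁ h₂
  exact abs_le.2 ⟨by linarith, by linarith⟩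

lemma exists_zpow_le_of_mem_Icc {a : ℝ} (ha : 0 < a) (m : ℤ) :
    ∃ B : ℝ, 0 < B ∧ ∀ x, a ≤ x → x ≤ 1 → x ^ m ≤ B := by
  refine ⟨1 + a ^ m, by positivity, fun x hax hx => ?_⟩
  have hx0 : 0 < x := ha.trans_le hax
  rcases le_or_gt 0 m with hm | hm
  · linarith [zpow_le_one₀ hx0 hx hm, zpow_pos ha m]
  · have h := inv_anti₀ (zpow_pos ha (-m)) (zpow_le_zpow_left₀ (n := -m) (by omega) ha.le hax)
    rw [zpow_neg, zpow_neg, inv_inv, inv_inv] at h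
    linarith

lemma exists_abs_le_of_transport {M : ℝ} (hM : 0 ≤ M) {ρ : ℝ → ℝ} {u₀ R : ℝ} (hR : 2 * M < R)
    (hρR : ∀ u ≤ u₀, R ≤ ρ u) (hρ : ∀ u ≤ u₀, HasDerivAt ρ (-(1 - 2 * M / ρ u)) u)
    (hρtop : Tendsto ρ atBot atTop) {m : ℤ} {p ε K : ℝ} (hε : 0 < ε) (hmp : 0 < m + p)
    (hK : 0 ≤ K) {E E' : ℝ → ℝ} (hE : ∀ u ≤ u₀, HasDerivAt E (E' u) u)
    (hE' : ∀ u ≤ u₀, |E' u + (2 * m * (1 - 2 * M / ρ u) / ρ u - 2 * M * m / ρ u ^ 2) * E u|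
      ≤ K * (ρ u ^ ((m : ℝ) - 1 - p - ε) + M * ρ u ^ ((m : ℝ) - 1 - p - 1)))
    (hlim : Tendsto (fun u => ρ u ^ (-(2 * m)) * E u) atBot (𝓝 0)) :
    ∃ C : ℝ, 0 ≤ C ∧ ∀ u ≤ u₀,
      |E u| ≤ C * (ρ u ^ ((m : ℝ) - p - ε) + M * ρ u ^ ((m : ℝ) - p - 1)) := by
  have hR0 : 0 < R := by linarith
  set a : ℝ := 1 - 2 * M / R with ha_def
  have ha : 0 < a := by
    rw [ha_def, sub_pos, div_lt_one hR0]; exact hR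
  have hρ0 : ∀ u ≤ u₀, 0 < ρ u := fun u hu => hR0.trans_le (hρR u hu)
  have haD : ∀ u ≤ u₀, a ≤ 1 - 2 * M / ρ u := fun u hu => by
    have := div_le_div_of_nonneg_left (by linarith : 0 ≤ 2 * M) hR0 (hρR u hu)
    linarith
  have hD1 : ∀ u ≤ u₀, 1 - 2 * M / ρ u ≤ 1 := fun u hu => by
    have : 0 ≤ 2 * M / ρ u := div_nonneg (by linarith) (hρ0 u hu).le
    linarith
  obtain ⟨B, hB0, hB⟩ := exists_zpow_le_of_mem_Icc ha m
  obtain ⟨B', hB'0, hB'⟩ := exists_zpow_le_of_mem_Icc ha (-m)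
  set L : ℝ := B * K / (a * (m + p)) with hL
  have hL0 : 0 ≤ L := by positivity
  have hLeq : L * (a * (m + p)) = B * K := div_mul_cancel₀ _ (by positivity)
  set F : ℝ → ℝ := fun u => (1 - 2 * M / ρ u) ^ m * ρ u ^ (-(2 * m)) * E u with hF
  set G : ℝ → ℝ := fun u => L * (ρ u ^ (-((m : ℝ) + p + ε)) + M * ρ u ^ (-((m : ℝ) + p + 1)))
    with hG
  have hFd : ∀ u ≤ u₀, HasDerivAt F ((1 - 2 * M / ρ u) ^ m * ρ u ^ (-(2 * m)) *
      (E' u + (2 * m * (1 - 2 * M / ρ u) / ρ u - 2 * M * m / ρ u ^ 2) * E u)) u := by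
    intro u hu
    have hρne := (hρ0 u hu).ne'
    have hDne := (ha.trans_le (haD u hu)).ne'
    have hDd : HasDerivAt (fun u => 1 - 2 * M / ρ u)
        (-(2 * M * (1 - 2 * M / ρ u)) / ρ u ^ 2) u := by
      refine (((hasDerivAt_const u (2 * M)).div (hρ u hu) hρne).const_sub 1).congr_deriv ?_
      ring
    have h₁ := (hasDerivAt_zpow m _ (Or.inl hDne)).comp u hDd
    have h₂ := (hasDerivAt_zpow (-(2 * m)) _ (Or.inl hρne)).comp u (hρ u hu)
    refine ((h₁.mul h₂).mul (hE u hu)).congr_deriv ?_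
    simp only [Function.comp, Pi.mul_apply]
    rw [zpow_sub_one₀ hDne, zpow_sub_one₀ hρne]
    generalize (1 - 2 * M / ρ u) ^ m = X
    generalize ρ u ^ (-(2 * m)) = Y
    generalize 1 - 2 * M / ρ u = D at *
    push_cast
    field_simp
    ring
  have hGd : ∀ u ≤ u₀, HasDerivAt G (L * ((1 - 2 * M / ρ u) *
      ((m + p + ε) * ρ u ^ (-((m : ℝ) + p + ε) - 1) +
        M * ((m + p + 1) * ρ u ^ (-((m : ℝ) + p + 1) - 1))))) u := by
    intro u hu
    have hρne := (hρ0 u hu).ne'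
    have h₁ := (hρ u hu).rpow_const (p := -((m : ℝ) + p + ε)) (Or.inl hρne)
    have h₂ := (hρ u hu).rpow_const (p := -((m : ℝ) + p + 1)) (Or.inl hρne)
    refine ((h₁.add (h₂.const_mul M)).const_mul L).congr_deriv ?_
    ring
  have hzr : ∀ u ≤ u₀, ∀ x : ℝ, ρ u ^ (-(2 * m)) * ρ u ^ x = ρ u ^ (x - 2 * m) := fun u hu x => by
    rw [← Real.rpow_intCast, ← Real.rpow_add (hρ0 u hu)]
    push_cast
    ring_nf
  have hzr' : ∀ u ≤ u₀, ∀ x : ℝ, ρ u ^ (2 * m) * ρ u ^ x = ρ u ^ (x + 2 * m) := fun u hu x => by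
    rw [← Real.rpow_intCast, ← Real.rpow_add (hρ0 u hu)]
    push_cast
    ring_nf
  have hle : ∀ u ≤ u₀, |(1 - 2 * M / ρ u) ^ m * ρ u ^ (-(2 * m)) *
      (E' u + (2 * m * (1 - 2 * M / ρ u) / ρ u - 2 * M * m / ρ u ^ 2) * E u)| ≤
      L * ((1 - 2 * M / ρ u) * ((m + p + ε) * ρ u ^ (-((m : ℝ) + p + ε) - 1) +
        M * ((m + p + 1) * ρ u ^ (-((m : ℝ) + p + 1) - 1)))) := by
    intro u hu
    have hρp := hρ0 u hu
    have hDa := haD u hu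
    have hDp := ha.trans_le hDa
    set S := ρ u ^ (-((m : ℝ) + p + ε) - 1) with hS
    set T := ρ u ^ (-((m : ℝ) + p + 1) - 1) with hT
    have hS0 : 0 ≤ S := by positivity
    have hT0 : 0 ≤ T := by positivity
    rw [abs_mul, abs_of_nonneg (by positivity)]
    calc _ ≤ (1 - 2 * M / ρ u) ^ m * ρ u ^ (-(2 * m)) *
          (K * (ρ u ^ ((m : ℝ) - 1 - p - ε) + M * ρ u ^ ((m : ℝ) - 1 - p - 1))) := by
            gcongr; exact hE' u hu
      _ = (1 - 2 * M / ρ u) ^ m * (K * (S + M * T)) := by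
          have e₁ := hzr u hu ((m : ℝ) - 1 - p - ε)
          have e₂ := hzr u hu ((m : ℝ) - 1 - p - 1)
          rw [show (m : ℝ) - 1 - p - ε - 2 * m = -((m : ℝ) + p + ε) - 1 by ring] at e₁
          rw [show (m : ℝ) - 1 - p - 1 - 2 * m = -((m : ℝ) + p + 1) - 1 by ring] at e₂
          rw [hS, hT, ← e₁, ← e₂]
          ring
      _ ≤ B * (K * (S + M * T)) := by
          gcongr; exact hB _ hDa (hD1 u hu)
      _ = L * (a * ((m + p) * S + M * ((m + p) * T))) := by
          linear_combination (-(S + M * T)) * hLeq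
      _ ≤ _ := by
          have h₁ : (m + p) * S ≤ (m + p + ε) * S := mul_le_mul_of_nonneg_right (by linarith) ‹_›
          have h₂ : (m + p) * T ≤ (m + p + 1) * T := mul_le_mul_of_nonneg_right (by linarith) ‹_›
          gcongr
  have hbdD : ∀ᶠ u in atBot, ‖(1 - 2 * M / ρ u) ^ m‖ ≤ B := by
    filter_upwards [eventually_le_atBot u₀] with u hu
    have hDa := haD u hu
    have hDp := ha.trans_le hDa
    rw [Real.norm_of_nonneg (by positivity)]
    exact hB _ hDa (hD1 u hu)
  have hF0 : Tendsto F atBot (𝓝 0) := by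
    have := hlim.zero_mul_isBoundedUnder_le (isBoundedUnder_of_eventually_le hbdD)
    refine this.congr fun u => ?_
    simp only [hF]; ring
  have hG0 : Tendsto G atBot (𝓝 0) := by
    have h₁ := (tendsto_rpow_neg_atTop (by linarith : 0 < (m : ℝ) + p + ε)).comp hρtop
    have h₂ := (tendsto_rpow_neg_atTop (by linarith : 0 < (m : ℝ) + p + 1)).comp hρtop
    have h := (h₁.add (h₂.const_mul M)).const_mul L
    rw [mul_zero, add_zero, mul_zero] at h
    exact h
  refine ⟨B' * L, by positivity, fun u hu => ?_⟩
  have hFG := abs_le_of_abs_deriv_le_of_tendsto_atBot hFd hGd hle hF0 hG0 hu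
  have hρp := hρ0 u hu
  have hDa := haD u hu
  have hDp := ha.trans_le hDa
  have hEF : E u = (1 - 2 * M / ρ u) ^ (-m) * ρ u ^ (2 * m) * F u := by
    have h₁ := (zpow_pos hDp m).ne'
    have h₂ := (zpow_pos hρp (2 * m)).ne'
    simp only [hF, zpow_neg]
    generalize (1 - 2 * M / ρ u) ^ m = X at *
    generalize ρ u ^ (2 * m) = Y at *
    field_simp
  have hGe : ρ u ^ (2 * m) * G u =
      L * (ρ u ^ ((m : ℝ) - p - ε) + M * ρ u ^ ((m : ℝ) - p - 1)) := by
    have e₁ := hzr' u hu (-((m : ℝ) + p + ε))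
    have e₂ := hzr' u hu (-((m : ℝ) + p + 1))
    rw [show -((m : ℝ) + p + ε) + 2 * m = (m : ℝ) - p - ε by ring] at e₁
    rw [show -((m : ℝ) + p + 1) + 2 * m = (m : ℝ) - p - 1 by ring] at e₂
    rw [← e₁, ← e₂, hG]
    ring
  have hG0' : 0 ≤ G u := (abs_nonneg _).trans hFG
  calc |E u| = (1 - 2 * M / ρ u) ^ (-m) * ρ u ^ (2 * m) * |F u| := by
        rw [hEF, abs_mul, abs_of_nonneg (a := _ * _) (by positivity)]
    _ ≤ B' * ρ u ^ (2 * m) * G u := by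
        gcongr; exact hB' _ hDa (hD1 u hu)
    _ = _ := by rw [mul_assoc, hGe]; ring

end TransportEstimate

section CommutedEquation

variable {M : ℝ} {U : Set (ℝ × ℝ)} {r : ℝ × ℝ → ℝ}

lemma Dfun_pos (hM : 0 ≤ M) (hr2M : ∀ p ∈ U, 2 * M < r p) {p : ℝ × ℝ} (hp : p ∈ U) :
    0 < Dfun M r p := by
  have := hr2M p hp
  rw [Dfun, sub_pos, div_lt_one (by linarith)]
  exact this

lemma contDiffOn_Dfun (hM : 0 ≤ M) (hr : ContDiffOn ℝ ∞ r U) (hr2M : ∀ p ∈ U, 2 * M < r p) :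
    ContDiffOn ℝ ∞ (Dfun M r) U :=
  contDiffOn_const.sub (contDiffOn_const.div hr fun p hp => by
    have := hr2M p hp
    linarith)

lemma contDiffOn_Pv (hM : 0 ≤ M) (hU : IsOpen U) (hr : ContDiffOn ℝ ∞ r U)
    (hr2M : ∀ p ∈ U, 2 * M < r p) {f : ℝ × ℝ → ℝ} (hf : ContDiffOn ℝ ∞ f U) :
    ContDiffOn ℝ ∞ (Pv M r f) U :=
  ((hr.pow 2).div (contDiffOn_Dfun hM hr hr2M) fun _ hp => (Dfun_pos hM hr2M hp).ne').mul
    (hf.pdv hU)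

lemma contDiffOn_iterate_Pv (hM : 0 ≤ M) (hU : IsOpen U) (hr : ContDiffOn ℝ ∞ r U)
    (hr2M : ∀ p ∈ U, 2 * M < r p) {f : ℝ × ℝ → ℝ} (hf : ContDiffOn ℝ ∞ f U) (n : ℕ) :
    ContDiffOn ℝ ∞ ((Pv M r)^[n] f) U := by
  induction n with
  | zero => exact hf
  | succ n ih => rw [Function.iterate_succ_apply']; exact contDiffOn_Pv hM hU hr hr2M ih

lemma HasDerivAt.one_sub_two_mul_div {ρ : ℝ → ℝ} {ρ' x : ℝ} (M : ℝ) (h : HasDerivAt ρ ρ' x)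
    (hx : ρ x ≠ 0) : HasDerivAt (fun x => 1 - 2 * M / ρ x) (2 * M * ρ' / ρ x ^ 2) x := by
  refine (((hasDerivAt_const x (2 * M)).div h hx).const_sub 1).congr_deriv ?_
  ring

lemma pdu_Pv (hM : 0 ≤ M) (hU : IsOpen U) (hr : ContDiffOn ℝ ∞ r U)
    (hr2M : ∀ p ∈ U, 2 * M < r p) (hru : ∀ p ∈ U, pdu r p = -(1 - 2 * M / r p))
    {f : ℝ × ℝ → ℝ} (hf : ContDiffOn ℝ ∞ f U) {p : ℝ × ℝ} (hp : p ∈ U) :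
    pdu (Pv M r f) p = (-2 * Dfun M r p / r p + 2 * M / r p ^ 2) * Pv M r f p
      + r p ^ 2 / Dfun M r p * pdu (pdv f) p := by
  have hD := (Dfun_pos hM hr2M hp).ne'
  have hrp : r p ≠ 0 := by linarith [hr2M p hp]
  have h₁ := hr.hasDerivAt_pdu hU hp
  have h₂ := h₁.one_sub_two_mul_div M hrp
  have h := (((h₁.pow 2).div h₂ hD).mul ((hf.pdv hU).hasDerivAt_pdu hU hp)).deriv
  refine h.trans ?_
  rw [hru p hp]
  simp only [Pi.pow_apply, Pi.div_apply, Pv, Dfun, Prod.mk.eta] at hD ⊢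
  generalize 1 - 2 * M / r p = D at *
  field_simp
  push_cast
  ring

/-- The transport equation for `W = Pv w` commuted once more with `Pv`. -/
lemma transport_Pv (hM : 0 ≤ M) (hU : IsOpen U) (hr : ContDiffOn ℝ ∞ r U)
    (hr2M : ∀ p ∈ U, 2 * M < r p) (hru : ∀ p ∈ U, pdu r p = -(1 - 2 * M / r p))
    (hrv : ∀ p ∈ U, pdv r p = 1 - 2 * M / r p) {w z : ℝ × ℝ → ℝ} {m L c e : ℝ}
    (hw : ContDiffOn ℝ ∞ w U) (hz : ContDiffOn ℝ ∞ z U)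
    (h : ∀ p ∈ U, pdu (Pv M r w) p
      + (2 * m * Dfun M r p / r p - 2 * M * m / r p ^ 2) * Pv M r w p
      = (L - 2 * M * c / r p) * w p + 2 * M * e * z p) {p : ℝ × ℝ} (hp : p ∈ U) :
    pdu (Pv M r (Pv M r w)) p
      + (2 * (m + 1) * Dfun M r p / r p - 2 * M * (m + 1) / r p ^ 2) * Pv M r (Pv M r w) p
      = (L + 2 * m - 2 * M * (c + 6 * m) / r p) * Pv M r w p
        + 2 * M * (c * w p + e * Pv M r z p) := by
  have hD := (Dfun_pos hM hr2M hp).ne'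
  have hrp : r p ≠ 0 := by linarith [hr2M p hp]
  have hW := contDiffOn_Pv hM hU hr hr2M hw
  have h₁ := hr.hasDerivAt_pdv hU hp
  have h₂ := h₁.one_sub_two_mul_div M hrp
  have hl := ((hW.pdu hU).hasDerivAt_pdv hU hp).add
    ((((h₂.const_mul (2 * m)).div h₁ hrp).sub
      ((hasDerivAt_const p.2 (2 * M * m)).div (h₁.pow 2) (pow_ne_zero 2 hrp))).mul
      (hW.hasDerivAt_pdv hU hp))
  have hrt := ((((hasDerivAt_const p.2 (2 * M * c)).div h₁ hrp).const_sub L).mul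
    (hw.hasDerivAt_pdv hU hp)).add ((hz.hasDerivAt_pdv hU hp).const_mul (2 * M * e))
  have key := (hl.congr_of_eventuallyEq
    ((eventually_snd_slice_mem hU hp).mono fun y hy => (h _ hy).symm)).unique hrt
  rw [hrv p hp] at key
  simp only [Pi.pow_apply, Pi.div_apply, Pi.sub_apply, Prod.mk.eta] at key
  rw [pdu_Pv hM hU hr hr2M hru hW hp, pdu_pdv_comm hU hW hp]
  have hPw : pdv w p = Dfun M r p / r p ^ 2 * Pv M r w p := by
    simp only [Pv]; field_simp
  have hPW : pdv (Pv M r w) p = Dfun M r p / r p ^ 2 * Pv M r (Pv M r w) p := by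
    conv_rhs => rw [Pv]
    field_simp
  have hPz : pdv z p = Dfun M r p / r p ^ 2 * Pv M r z p := by
    simp only [Pv]; field_simp
  rw [hPw, hPW, hPz] at key
  have hMD : 2 * M = (1 - Dfun M r p) * r p := by simp only [Dfun]; field_simp; ring
  rw [show 1 - 2 * M / r p = Dfun M r p from rfl] at key
  have hkey := eq_sub_of_add_eq key
  rw [hkey]
  generalize Dfun M r p = D at *
  generalize Pv M r (Pv M r w) p = X₂ at *
  generalize Pv M r w p = X₁ at *
  generalize Pv M r z p = Z₁ at *
  generalize w p = X₀ at *
  obtain rfl : M = (1 - D) * r p / 2 := by linarith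
  field_simp
  push_cast
  ring

lemma TeukSol.transport {s ℓ : ℤ} {α : ℝ × ℝ → ℝ} (hT : TeukSol M r U s ℓ α) (hM : 0 ≤ M)
    (hU : IsOpen U) (hr : ContDiffOn ℝ ∞ r U)
    (hr2M : ∀ p ∈ U, 2 * M < r p) (hru : ∀ p ∈ U, pdu r p = -(1 - 2 * M / r p))
    (hα : ContDiffOn ℝ ∞ α U) {p : ℝ × ℝ} (hp : p ∈ U) :
    pdu (Pv M r α) p
      + (2 * (s + 1) * Dfun M r p / r p - 2 * M * (s + 1) / r p ^ 2) * Pv M r α p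
      = (-(ℓ - s) * (ℓ + s + 1) - 2 * M * ((1 + s) * (1 + 2 * s)) / r p) * α p := by
  have hD := (Dfun_pos hM hr2M hp).ne'
  have hrp : r p ≠ 0 := by linarith [hr2M p hp]
  have h₁ := hr.hasDerivAt_pdu hU hp
  have h₂ := h₁.one_sub_two_mul_div M hrp
  have h₃ : HasDerivAt (fun x => r (x, p.2) ^ (-(2 * s))) _ p.1 :=
    HasDerivAt.comp (h₂ := fun x : ℝ => x ^ (-(2 * s))) p.1 (hasDerivAt_zpow _ _ (Or.inl hrp)) h₁
  have h₄ : HasDerivAt (fun x => Dfun M r (x, p.2) ^ s) _ p.1 :=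
    HasDerivAt.comp (h₂ := fun x : ℝ => x ^ s) p.1 (hasDerivAt_zpow _ _ (Or.inl hD)) h₂
  have h := ((h₃.fun_mul h₄).fun_mul ((hα.pdv hU).hasDerivAt_pdu hU hp)).deriv.symm.trans (hT p hp)
  rw [hru p hp] at h
  simp only [Prod.mk.eta] at h
  rw [show 1 - 2 * M / r p = Dfun M r p from rfl, show -2 - 2 * s = -(2 * s) - 1 - 1 by ring,
    show -3 - 2 * s = -(2 * s) - 1 - 1 - 1 by ring] at h
  simp only [zpow_sub_one₀ hrp, zpow_sub_one₀ hD, zpow_add_one₀ hD] at h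
  rw [pdu_Pv hM hU hr hr2M hru hα hp]
  simp only [Pv]
  have hX := zpow_ne_zero (-(2 * s)) hrp
  have hY := zpow_ne_zero s hD
  generalize r p ^ (-(2 * s)) = X at *
  generalize Dfun M r p ^ s = Y at *
  generalize Dfun M r p = D at *
  generalize pdu (pdv α) p = H at *
  generalize pdv α p = G at *
  push_cast at h
  refine mul_left_cancel₀ (mul_ne_zero (mul_ne_zero hX hY) (div_ne_zero hD (pow_ne_zero 2 hrp))) ?_
  field_simp at h ⊢
  linear_combination h

/-- The hierarchy of transport equations satisfied by the iterates of `Pv`. -/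
lemma TeukSol.exists_transport_iterate {s ℓ : ℤ} {α : ℝ × ℝ → ℝ} (hT : TeukSol M r U s ℓ α)
    (hM : 0 ≤ M) (hU : IsOpen U) (hr : ContDiffOn ℝ ∞ r U) (hr2M : ∀ p ∈ U, 2 * M < r p)
    (hru : ∀ p ∈ U, pdu r p = -(1 - 2 * M / r p)) (hrv : ∀ p ∈ U, pdv r p = 1 - 2 * M / r p)
    (hα : ContDiffOn ℝ ∞ α U) (N : ℕ) :
    ∃ c e : ℝ, (N = 0 → e = 0) ∧ ∀ p ∈ U, pdu ((Pv M r)^[N + 1] α) p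
      + (2 * (N + s + 1) * Dfun M r p / r p - 2 * M * (N + s + 1) / r p ^ 2)
        * (Pv M r)^[N + 1] α p
      = (-(ℓ - s - N) * (ℓ + s + N + 1) - 2 * M * c / r p) * (Pv M r)^[N] α p
        + 2 * M * e * (Pv M r)^[N - 1] α p := by
  induction N with
  | zero =>
    refine ⟨(1 + s) * (1 + 2 * s), 0, fun _ => rfl, fun p hp => ?_⟩
    have h := hT.transport hM hU hr hr2M hru hα hp
    simp only [zero_add, Function.iterate_one, Function.iterate_zero, id_eq, Nat.cast_zero]
    linear_combination h
  | succ N ih =>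
    obtain ⟨c, e, he, h⟩ := ih
    refine ⟨c + 6 * (N + s + 1), c + e, by simp, fun p hp => ?_⟩
    have hw := contDiffOn_iterate_Pv hM hU hr hr2M hα N
    have hz := contDiffOn_iterate_Pv hM hU hr hr2M hα (N - 1)
    simp only [Function.iterate_succ_apply' (Pv M r) N] at h
    have key := transport_Pv hM hU hr hr2M hru hrv hw hz h hp
    have hez : e * Pv M r ((Pv M r)^[N - 1] α) p = e * (Pv M r)^[N] α p := by
      rcases N with _ | N
      · simp [he rfl]
      · rw [← Function.iterate_succ_apply' (Pv M r)]; rfl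
    rw [hez] at key
    rw [Nat.add_sub_cancel, Function.iterate_succ_apply' (Pv M r) (N + 1),
      Function.iterate_succ_apply' (Pv M r) N]
    push_cast
    linear_combination key

end CommutedEquation

section ConeDecay

variable {M : ℝ} {U : Set (ℝ × ℝ)} {r : ℝ × ℝ → ℝ}

lemma iterate_Pv_eq_add (hM : 0 ≤ M) (hU : IsOpen U) (hr : ContDiffOn ℝ ∞ r U)
    (hr2M : ∀ p ∈ U, 2 * M < r p) {f f₁ f₂ : ℝ × ℝ → ℝ} (hf₁ : ContDiffOn ℝ ∞ f₁ U)
    (hf₂ : ContDiffOn ℝ ∞ f₂ U) (hf : ∀ p ∈ U, f p = f₁ p + f₂ p) (N : ℕ) :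
    ∀ p ∈ U, (Pv M r)^[N] f p = (Pv M r)^[N] f₁ p + (Pv M r)^[N] f₂ p := by
  induction N generalizing f f₁ f₂ with
  | zero => exact hf
  | succ N ih =>
    refine ih (contDiffOn_Pv hM hU hr hr2M hf₁) (contDiffOn_Pv hM hU hr hr2M hf₂) fun p hp => ?_
    have h := ((hf₁.hasDerivAt_pdv hU hp).fun_add (hf₂.hasDerivAt_pdv hU hp)).deriv
    rw [Pv, pdv_congr (g := fun p => f₁ p + f₂ p) hU hf hp, pdv, h, Pv, Pv]
    ring

lemma isOpen_setOf_two_mul_mul_lt_one (M : ℝ) : IsOpen {x : ℝ | 2 * M * x < 1} :=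
  isOpen_lt (by fun_prop) continuous_const

lemma contDiffOn_weighted (hM : 0 ≤ M) (hr : ContDiffOn ℝ ∞ r U)
    (hr2M : ∀ p ∈ U, 2 * M < r p) (i : ℕ) {q : ℝ → ℝ}
    (hq : ContDiffOn ℝ ∞ q {x | 2 * M * x < 1}) {g : ℝ × ℝ → ℝ} (hg : ContDiffOn ℝ ∞ g U) :
    ContDiffOn ℝ ∞ (fun p => r p ^ (2 * i) * q (r p)⁻¹ * g p) U := by
  refine ((hr.pow _).mul (hq.comp (hr.inv fun p hp => ?_) fun p hp => ?_)).mul hg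
  · linarith [hr2M p hp]
  · have := hr2M p hp
    change 2 * M * (r p)⁻¹ < 1
    rw [← div_eq_mul_inv, div_lt_one (by linarith)]
    exact this

lemma Pv_weighted (hM : 0 ≤ M) (hU : IsOpen U) (hr : ContDiffOn ℝ ∞ r U)
    (hr2M : ∀ p ∈ U, 2 * M < r p) (hrv : ∀ p ∈ U, pdv r p = 1 - 2 * M / r p) (i : ℕ) {q : ℝ → ℝ}
    (hq : ContDiffOn ℝ ∞ q {x | 2 * M * x < 1}) {f g : ℝ × ℝ → ℝ} (hg : ContDiffOn ℝ ∞ g U)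
    (hf : ∀ p ∈ U, f p = r p ^ (2 * i) * q (r p)⁻¹ * g p) {p : ℝ × ℝ} (hp : p ∈ U) :
    Pv M r f p =
      r p ^ (2 * (i + 1)) * (2 * i * (r p)⁻¹ * q (r p)⁻¹ - (r p)⁻¹ ^ 2 * deriv q (r p)⁻¹) * g p
        + r p ^ (2 * (i + 1)) * (q (r p)⁻¹ / (1 - 2 * M * (r p)⁻¹)) * pdv g p := by
  have hD := (Dfun_pos hM hr2M hp).ne'
  have hrp : r p ≠ 0 := by linarith [hr2M p hp]
  have h₁ := hr.hasDerivAt_pdv hU hp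
  have hx : 2 * M * (r p)⁻¹ < 1 := by
    have := Dfun_pos hM hr2M hp
    rw [Dfun, div_eq_mul_inv] at this
    linarith
  have hqd : HasDerivAt q (deriv q (r p)⁻¹) (r p)⁻¹ :=
    ((hq.contDiffAt ((isOpen_setOf_two_mul_mul_lt_one M).mem_nhds hx)).differentiableAt
      (by simp)).hasDerivAt
  have hq' : HasDerivAt (fun y => q (r (p.1, y))⁻¹) _ p.2 := hqd.comp p.2 (h₁.fun_inv hrp)
  have h := (((h₁.fun_pow (2 * i)).fun_mul hq').fun_mul (hg.hasDerivAt_pdv hU hp)).deriv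
  rw [Pv, pdv_congr hU hf hp, pdv, h, hrv p hp]
  simp only [Prod.mk.eta]
  rw [show 1 - 2 * M * (r p)⁻¹ = Dfun M r p by rw [Dfun, div_eq_mul_inv],
    show 1 - 2 * M / r p = Dfun M r p from rfl]
  have hpow : ((2 * i : ℕ) : ℝ) * r p ^ (2 * i - 1) = 2 * i * r p ^ (2 * i) / r p := by
    rcases i with _ | i
    · simp
    · rw [show 2 * (i + 1) - 1 = 2 * i + 1 by omega, show 2 * (i + 1) = 2 * i + 1 + 1 by omega,
        pow_succ (r p) (2 * i + 1)]
      push_cast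
      field_simp
      ring
  rw [hpow, show 2 * (i + 1) = 2 * i + 2 by omega, pow_add]
  field_simp
  ring

lemma tendsto_iterate_Pv_weighted (hM : 0 ≤ M) (hU : IsOpen U) (hr : ContDiffOn ℝ ∞ r U)
    (hr2M : ∀ p ∈ U, 2 * M < r p) (hrv : ∀ p ∈ U, pdv r p = 1 - 2 * M / r p) {v₁ u₀ : ℝ}
    (hray : ∀ u ≤ u₀, (u, v₁) ∈ U) (hr0 : Tendsto (fun u => r (u, v₁)) atBot atTop) (s : ℤ)
    (N i : ℕ) {q : ℝ → ℝ} (hq : ContDiffOn ℝ ∞ q {x | 2 * M * x < 1}) {f g : ℝ × ℝ → ℝ}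
    (hg : ContDiffOn ℝ ∞ g U)
    (hdecay : ∀ n : ℕ, Tendsto (fun u => r (u, v₁) ^ (-(2 * s)) * pdv^[n] g (u, v₁)) atBot (𝓝 0))
    (hf : ∀ p ∈ U, f p = r p ^ (2 * i) * q (r p)⁻¹ * g p) :
    Tendsto (fun u => r (u, v₁) ^ (-(2 * (s + (i + N : ℕ)))) * (Pv M r)^[N] f (u, v₁))
      atBot (𝓝 0) := by
  induction N generalizing i q f g with
  | zero =>
    have hq0 : Tendsto (fun u => q (r (u, v₁))⁻¹) atBot (𝓝 (q 0)) :=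
      (hq.contDiffAt ((isOpen_setOf_two_mul_mul_lt_one M).mem_nhds
        (by simp))).continuousAt.tendsto.comp hr0.inv_tendsto_atTop
    have h := hq0.mul (hdecay 0)
    rw [mul_zero] at h
    refine h.congr' ?_
    filter_upwards [eventually_le_atBot u₀] with u hu
    have hrp : r (u, v₁) ≠ 0 := by linarith [hr2M _ (hray u hu)]
    simp only [Function.iterate_zero, id_eq, add_zero]
    rw [hf _ (hray u hu), mul_add, neg_add, zpow_add₀ hrp, zpow_neg _ (2 * (i : ℤ)),
      show (2 * (i : ℤ)) = ((2 * i : ℕ) : ℤ) by push_cast; rfl, zpow_natCast]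
    field_simp
  | succ N ih =>
    have hV := isOpen_setOf_two_mul_mul_lt_one M
    have hq₁ : ContDiffOn ℝ ∞ (fun x => 2 * i * x * q x - x ^ 2 * deriv q x)
        {x | 2 * M * x < 1} :=
      ((contDiffOn_const.mul contDiffOn_id).mul hq).sub
        ((contDiffOn_id.pow 2).mul (hq.deriv_of_isOpen hV (by simp)))
    have hq₂ : ContDiffOn ℝ ∞ (fun x => q x / (1 - 2 * M * x)) {x | 2 * M * x < 1} :=
      hq.div (contDiffOn_const.sub (contDiffOn_const.mul contDiffOn_id))
        fun x hx => (sub_pos.2 hx).ne'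
    have h₁ := ih (i + 1) hq₁ hg hdecay fun _ _ => rfl
    have h₂ := ih (i + 1) hq₂ (hg.pdv hU) (fun n => hdecay (n + 1)) fun _ _ => rfl
    have h := h₁.add h₂
    rw [add_zero] at h
    refine h.congr' ?_
    filter_upwards [eventually_le_atBot u₀] with u hu
    rw [Function.iterate_succ_apply, iterate_Pv_eq_add hM hU hr hr2M
      (contDiffOn_weighted hM hr hr2M (i + 1) hq₁ hg)
      (contDiffOn_weighted hM hr hr2M (i + 1) hq₂ (hg.pdv hU))
      (fun p hp => Pv_weighted hM hU hr hr2M hrv i hq hg hf hp) N _ (hray u hu),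
      show i + 1 + N = i + (N + 1) by omega]
    ring

lemma tendsto_iterate_succ_Pv (hM : 0 ≤ M) (hU : IsOpen U) (hr : ContDiffOn ℝ ∞ r U)
    (hr2M : ∀ p ∈ U, 2 * M < r p) (hrv : ∀ p ∈ U, pdv r p = 1 - 2 * M / r p) {v₁ u₀ : ℝ}
    (hray : ∀ u ≤ u₀, (u, v₁) ∈ U) (hr0 : Tendsto (fun u => r (u, v₁)) atBot atTop) {s : ℤ}
    {α : ℝ × ℝ → ℝ} (hα : ContDiffOn ℝ ∞ α U)
    (hdecay : ∀ n : ℕ, 1 ≤ n →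
      Tendsto (fun u => r (u, v₁) ^ (-(2 * s)) * pdv^[n] α (u, v₁)) atBot (𝓝 0)) (N : ℕ) :
    Tendsto (fun u => r (u, v₁) ^ (-(2 * (N + s + 1))) * (Pv M r)^[N + 1] α (u, v₁))
      atBot (𝓝 0) := by
  have hq : ContDiffOn ℝ ∞ (fun x => (1 - 2 * M * x)⁻¹) {x | 2 * M * x < 1} :=
    (contDiffOn_const.sub (contDiffOn_const.mul contDiffOn_id)).inv
      fun x hx => (sub_pos.2 hx).ne'
  have h := tendsto_iterate_Pv_weighted hM hU hr hr2M hrv hray hr0 s N 1 (f := Pv M r α) hq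
    (hα.pdv hU) (fun n => hdecay (n + 1) (by omega)) fun p _ => by
      rw [Pv, Dfun]; ring
  refine h.congr fun u => ?_
  rw [Function.iterate_succ_apply]
  congr 2
  push_cast
  ring

end ConeDecay

section Coefficients

lemma zfactR_add_one {n : ℤ} (hn : 0 ≤ n) : zfactR (n + 1) = (n + 1) * zfactR n := by
  obtain ⟨k, rfl⟩ := Int.eq_ofNat_of_zero_le hn
  rw [zfactR, zfactR, show ((k : ℤ) + 1).toNat = k + 1 by omega, Int.toNat_natCast,
    Nat.factorial_succ]
  push_cast
  ring

lemma zfactR_pos (n : ℤ) : 0 < zfactR n := Nat.cast_pos.2 (Nat.factorial_pos _)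

/-- The coefficient of the leading term of the `N`-th transversal derivative. -/
def coneCoeff (s ℓ : ℤ) (p : ℝ) (N : ℕ) : ℝ :=
  Real.Gamma ((s : ℝ) + p + 1) / Real.Gamma ((N : ℝ) + (s : ℝ) + p + 1) *
    (-1 : ℝ) ^ N * (zfactR (ℓ - s) * zfactR ((N : ℤ) + s + ℓ)) /
    (zfactR (ℓ - s - (N : ℤ)) * zfactR (ℓ + s))

lemma coneCoeff_zero {s : ℤ} (ℓ : ℤ) {p : ℝ} (hp : 0 < (s : ℝ) + p + 1) :
    coneCoeff s ℓ p 0 = 1 := by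
  have h₁ := (Real.Gamma_pos_of_pos hp).ne'
  have h₂ := (zfactR_pos (ℓ - s)).ne'
  have h₃ := (zfactR_pos (ℓ + s)).ne'
  simp only [coneCoeff, Nat.cast_zero, zero_add, sub_zero, pow_zero]
  rw [add_comm s ℓ]
  field_simp

lemma coneCoeff_succ {s ℓ : ℤ} {p : ℝ} (hp : 0 < (s : ℝ) + p + 1) {N : ℕ} (hsl : 0 ≤ ℓ + s)
    (hN : (N : ℤ) + 1 ≤ ℓ - s) :
    coneCoeff s ℓ p (N + 1) * (N + s + 1 + p) =
      -(ℓ - s - N) * (ℓ + s + N + 1) * coneCoeff s ℓ p N := by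
  have hpos : 0 < (N : ℝ) + s + p + 1 := by
    have : (0 : ℝ) ≤ N := N.cast_nonneg
    linarith
  have h₁ := (Real.Gamma_pos_of_pos hpos).ne'
  have h₂ := (zfactR_pos (ℓ - s - (N + 1))).ne'
  have h₃ := (zfactR_pos (ℓ + s)).ne'
  have e₁ : Real.Gamma (((N + 1 : ℕ) : ℝ) + s + p + 1)
      = (N + s + p + 1) * Real.Gamma ((N : ℝ) + s + p + 1) := by
    rw [← Real.Gamma_add_one hpos.ne']
    push_cast
    ring_nf
  have e₂ : zfactR (((N + 1 : ℕ) : ℤ) + s + ℓ) = (ℓ + s + N + 1) * zfactR (N + s + ℓ) := by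
    rw [show ((N + 1 : ℕ) : ℤ) + s + ℓ = N + s + ℓ + 1 by push_cast; ring,
      zfactR_add_one (by omega)]
    push_cast
    ring
  have e₃ : zfactR (ℓ - s - N) = (ℓ - s - N) * zfactR (ℓ - s - (N + 1)) := by
    rw [show ℓ - s - N = ℓ - s - (N + 1) + 1 by ring, zfactR_add_one (by omega)]
    push_cast
    ring
  have hne : (ℓ : ℝ) - s - N ≠ 0 := by
    have : (ℓ - s - N : ℤ) ≠ 0 := by omega
    exact_mod_cast this
  rw [coneCoeff, coneCoeff, e₁, e₂, e₃]
  push_cast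
  field_simp
  ring

end Coefficients

lemma exists_abs_le_rpow_of_expansion {M R x ε B C : ℝ} (hM : 0 ≤ M) (hR : 0 < R) (hε : 0 < ε)
    (hC : 0 ≤ C) {ρ f : ℝ → ℝ} {u₀ : ℝ} (hρR : ∀ u ≤ u₀, R ≤ ρ u)
    (h : ∀ u ≤ u₀, |f u - B * ρ u ^ x| ≤ C * (ρ u ^ (x - ε) + M * ρ u ^ (x - 1))) :
    ∃ K : ℝ, 0 ≤ K ∧ ∀ u ≤ u₀, |f u| ≤ K * ρ u ^ x := by
  refine ⟨|B| + C * (R ^ (-ε) + M * R ^ (-1 : ℝ)), by positivity, fun u hu => ?_⟩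
  have hρp := hR.trans_le (hρR u hu)
  have h₁ : ρ u ^ (-ε) ≤ R ^ (-ε) := Real.rpow_le_rpow_of_nonpos hR (hρR u hu) (by linarith)
  have h₂ : ρ u ^ (-1 : ℝ) ≤ R ^ (-1 : ℝ) :=
    Real.rpow_le_rpow_of_nonpos hR (hρR u hu) (by norm_num)
  calc |f u| = |B * ρ u ^ x + (f u - B * ρ u ^ x)| := by ring_nf
    _ ≤ |B * ρ u ^ x| + |f u - B * ρ u ^ x| := abs_add_le _ _
    _ ≤ |B| * ρ u ^ x + C * (ρ u ^ x * ρ u ^ (-ε) + M * (ρ u ^ x * ρ u ^ (-1 : ℝ))) := by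
        rw [abs_mul, abs_of_pos (Real.rpow_pos_of_pos hρp x), ← Real.rpow_add hρp,
          ← Real.rpow_add hρp, ← sub_eq_add_neg, ← sub_eq_add_neg]
        gcongr
        exact h u hu
    _ ≤ |B| * ρ u ^ x + C * (ρ u ^ x * R ^ (-ε) + M * (ρ u ^ x * R ^ (-1 : ℝ))) := by gcongr
    _ = _ := by ring

/-- Fixed-angular-mode form of Proposition 9.4 on transversal derivatives along the
initial ingoing cone `{v = v₁, u ≤ u₀}`. -/
theorem transversal_derivatives_along_initial_cone
    (M : ℝ) (hM : 0 ≤ M)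
    (U : Set (ℝ × ℝ)) (hUopen : IsOpen U)
    (r : ℝ × ℝ → ℝ) (hr : ContDiffOn ℝ ∞ r U)
    (hr2M : ∀ p ∈ U, 2 * M < r p)
    (hru : ∀ p ∈ U, pdu r p = -(1 - 2 * M / r p))
    (hrv : ∀ p ∈ U, pdv r p = 1 - 2 * M / r p)
    (s ℓ : ℤ) (hsl : |s| ≤ ℓ)
    (α : ℝ × ℝ → ℝ) (hα : ContDiffOn ℝ ∞ α U)
    (hTeuk : TeukSol M r U s ℓ α)
    (v₁ u₀ : ℝ) (hray : ∀ u : ℝ, u ≤ u₀ → (u, v₁) ∈ U)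
    (hr0 : Filter.Tendsto (fun u => r (u, v₁)) Filter.atBot Filter.atTop)
    (A C ε p : ℝ) (hC : 0 ≤ C) (hε : 0 < ε)
    (hp : max (-(s : ℝ) - 1) (-(1 : ℝ) / 2) < p)
    (hdata : ∀ u : ℝ, u ≤ u₀ →
      |α (u, v₁) - A * r (u, v₁) ^ ((s : ℝ) - p)| ≤ C * r (u, v₁) ^ ((s : ℝ) - p - ε))
    (hdecay : ∀ n : ℕ, 1 ≤ n →
      Filter.Tendsto (fun u => r (u, v₁) ^ (-(2 * s)) * ((pdv)^[n] α) (u, v₁))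
        Filter.atBot (nhds 0)) :
    ∀ N : ℕ, (N : ℤ) ≤ ℓ - s →
      ∃ C' : ℝ, 0 ≤ C' ∧ ∀ u : ℝ, u ≤ u₀ →
        |((Pv M r)^[N] α) (u, v₁)
            - A * (Real.Gamma ((s : ℝ) + p + 1) / Real.Gamma ((N : ℝ) + (s : ℝ) + p + 1) *
                (-1 : ℝ) ^ N * (zfactR (ℓ - s) * zfactR ((N : ℤ) + s + ℓ)) /
                (zfactR (ℓ - s - (N : ℤ)) * zfactR (ℓ + s))) *
              r (u, v₁) ^ ((N : ℝ) + (s : ℝ) - p)|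
          ≤ C' * (r (u, v₁) ^ ((N : ℝ) + (s : ℝ) - p - ε)
              + M * r (u, v₁) ^ ((N : ℝ) + (s : ℝ) - p - 1)) := by
  have hℓs : 0 ≤ ℓ + s := by have := neg_abs_le s; omega
  have hsp : 0 < (s : ℝ) + p + 1 := by linarith [(le_max_left _ _).trans_lt hp]
  set ρ : ℝ → ℝ := fun u => r (u, v₁) with hρ_def
  set w : ℕ → ℝ → ℝ := fun N u => (Pv M r)^[N] α (u, v₁) with hw_def
  have hρ : ∀ u ≤ u₀, HasDerivAt ρ (-(1 - 2 * M / ρ u)) u := fun u hu => by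
    have h := hr.hasDerivAt_pdu hUopen (hray u hu)
    rwa [hru _ (hray u hu)] at h
  set R : ℝ := ρ u₀ with hR_def
  have hR : 2 * M < R := hr2M _ (hray u₀ le_rfl)
  have hR0 : 0 < R := by linarith
  have hρR : ∀ u ≤ u₀, R ≤ ρ u := by
    have hanti : AntitoneOn ρ (Iic u₀) := by
      refine antitoneOn_of_deriv_nonpos (convex_Iic u₀)
        (fun x hx => (hρ x hx).continuousAt.continuousWithinAt)
        (fun x hx => (hρ x (mem_Iic.1 (interior_subset hx))).differentiableAt.differentiableWithinAt)
        fun x hx => ?_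
      have hx' := mem_Iic.1 (interior_subset hx)
      rw [(hρ x hx').deriv]
      exact (neg_lt_zero.2 (Dfun_pos hM hr2M (hray x hx'))).le
    exact fun u hu => hanti hu (mem_Iic.2 le_rfl) hu
  have hsmooth := contDiffOn_iterate_Pv hM hUopen hr hr2M hα
  have main : ∀ N : ℕ, (N : ℤ) ≤ ℓ - s → ∀ n ∈ ({N, N - 1} : Set ℕ),
      ∃ C' : ℝ, 0 ≤ C' ∧ ∀ u ≤ u₀,
        |w n u - A * coneCoeff s ℓ p n * ρ u ^ ((n : ℝ) + s - p)| ≤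
          C' * (ρ u ^ ((n : ℝ) + s - p - ε) + M * ρ u ^ ((n : ℝ) + s - p - 1)) := by
    intro N
    induction N with
    | zero =>
      intro _ n hn
      obtain rfl : n = 0 := by simpa using hn
      refine ⟨C, hC, fun u hu => ?_⟩
      have hρp := hR0.trans_le (hρR u hu)
      rw [coneCoeff_zero ℓ hsp]
      simp only [Nat.cast_zero, zero_add, mul_one]
      refine (hdata u hu).trans (mul_le_mul_of_nonneg_left ?_ hC)
      exact le_add_of_nonneg_right (mul_nonneg hM (Real.rpow_nonneg hρp.le _))
    | succ N ih =>
      intro hN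
      push_cast at hN
      have ihN := ih (by omega)
      rintro n (rfl | hn)
      swap
      · obtain rfl : n = N := by simpa using hn
        exact ihN n (by simp)
      obtain ⟨C₁, hC₁, h₁⟩ := ihN N (by simp)
      obtain ⟨C₂, hC₂, h₂⟩ := ihN (N - 1) (by simp)
      obtain ⟨c, e, he, heq⟩ :=
        hTeuk.exists_transport_iterate hM hUopen hr hr2M hru hrv hα N
      have hcoeff := coneCoeff_succ hsp hℓs hN
      obtain ⟨K₁, hK₁, hb₁⟩ := exists_abs_le_rpow_of_expansion hM hR0 hε hC₁ hρR h₁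
      obtain ⟨K₂, hK₂, hb₂⟩ : ∃ K : ℝ, 0 ≤ K ∧ ∀ u ≤ u₀,
          |e * w (N - 1) u| ≤ K * ρ u ^ ((N : ℝ) + s - p - 1) := by
        rcases N with _ | N
        · refine ⟨0, le_rfl, fun u _ => ?_⟩
          simp [he rfl]
        · obtain ⟨K, hK, hb⟩ := exists_abs_le_rpow_of_expansion hM hR0 hε hC₂ hρR h₂
          refine ⟨|e| * K, by positivity, fun u hu => ?_⟩
          rw [abs_mul, mul_assoc]
          refine mul_le_mul_of_nonneg_left ((hb u hu).trans_eq ?_) (abs_nonneg e)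
          congr 2
          rw [Nat.add_sub_cancel]
          push_cast
          ring
      set B : ℝ := A * coneCoeff s ℓ p (N + 1) with hB_def
      set Λ : ℝ := -(ℓ - s - N) * (ℓ + s + N + 1) with hΛ_def
      set y : ℝ := (N : ℝ) + s - p with hy_def
      set m : ℤ := N + s + 1 with hm_def
      have hmR : (m : ℝ) = N + s + 1 := by rw [hm_def]; push_cast; ring
      have hmp : 0 < (m : ℝ) + p := by
        have : (0 : ℝ) ≤ N := N.cast_nonneg
        linarith
      have hlimw : Tendsto (fun u => ρ u ^ (-(2 * m)) * w (N + 1) u) atBot (𝓝 0) :=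
        tendsto_iterate_succ_Pv hM hUopen hr hr2M hrv hray hr0 hα hdecay N
      have hlim : Tendsto (fun u => ρ u ^ (-(2 * m)) * (w (N + 1) u - B * ρ u ^ (y + 1)))
          atBot (𝓝 0) := by
        have h := hlimw.sub (((tendsto_rpow_neg_atTop hmp).comp hr0).const_mul B)
        rw [mul_zero, sub_zero] at h
        refine h.congr' ?_
        filter_upwards [eventually_le_atBot u₀] with u hu
        have hρp := hR0.trans_le (hρR u hu)
        have hz : ρ u ^ (-(2 * m)) * ρ u ^ (y + 1) = ρ u ^ (-((m : ℝ) + p)) := by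
          rw [← Real.rpow_intCast, ← Real.rpow_add hρp]
          congr 1
          push_cast
          rw [hmR, hy_def]
          ring
        change _ - B * ρ u ^ (-((m : ℝ) + p)) = _
        rw [← hz]
        ring
      have hE : ∀ u ≤ u₀, HasDerivAt (fun u => w (N + 1) u - B * ρ u ^ (y + 1))
          (pdu ((Pv M r)^[N + 1] α) (u, v₁)
            - B * (-(1 - 2 * M / ρ u) * (y + 1) * ρ u ^ y)) u := fun u hu => by
        have hρp := hR0.trans_le (hρR u hu)
        have h := ((hρ u hu).rpow_const (p := y + 1) (Or.inl hρp.ne')).const_mul B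
        rw [add_sub_cancel_right] at h
        exact ((hsmooth (N + 1)).hasDerivAt_pdu hUopen (hray u hu)).sub h
      have hres : ∀ u ≤ u₀, |pdu ((Pv M r)^[N + 1] α) (u, v₁)
          - B * (-(1 - 2 * M / ρ u) * (y + 1) * ρ u ^ y)
          + (2 * m * (1 - 2 * M / ρ u) / ρ u - 2 * M * m / ρ u ^ 2) *
            (w (N + 1) u - B * ρ u ^ (y + 1))|
          ≤ (|Λ| * C₁ + (2 * |c| * K₁ + 2 * K₂ + |2 * (2 * m + p) * B|)) *
            (ρ u ^ ((m : ℝ) - 1 - p - ε) + M * ρ u ^ ((m : ℝ) - 1 - p - 1)) := by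
        intro u hu
        have hρp := hR0.trans_le (hρR u hu)
        rw [show (m : ℝ) - 1 - p = y by rw [hmR, hy_def]; ring]
        set Z : ℝ := ρ u ^ (y - 1) with hZ_def
        have hZ0 : 0 ≤ Z := Real.rpow_nonneg hρp.le _
        have hy0 : ρ u ^ y = ρ u * Z := by
          rw [hZ_def, Real.rpow_sub_one hρp.ne']
          field_simp
        have hy1 : ρ u ^ (y + 1) = ρ u ^ 2 * Z := by
          rw [Real.rpow_add_one hρp.ne', hy0]
          ring
        have hb₁u := hb₁ u hu
        have hb₂u := hb₂ u hu
        have h₁u := h₁ u hu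
        have hequ := heq _ (hray u hu)
        rw [← hmR, show Dfun M r (u, v₁) = 1 - 2 * M / ρ u from rfl,
          show r (u, v₁) = ρ u from rfl, show (Pv M r)^[N + 1] α (u, v₁) = w (N + 1) u from rfl,
          show (Pv M r)^[N] α (u, v₁) = w N u from rfl,
          show (Pv M r)^[N - 1] α (u, v₁) = w (N - 1) u from rfl] at hequ
        have hBΛ : B * (m + p) = Λ * (A * coneCoeff s ℓ p N) := by
          rw [hmR, hB_def]
          linear_combination A * hcoeff
        have hym : y + 1 = m - p := by rw [hmR, hy_def]; ring
        have hid : pdu ((Pv M r)^[N + 1] α) (u, v₁) - B * (-(1 - 2 * M / ρ u) * (y + 1) * ρ u ^ y)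
            + (2 * m * (1 - 2 * M / ρ u) / ρ u - 2 * M * m / ρ u ^ 2) *
              (w (N + 1) u - B * ρ u ^ (y + 1))
            = Λ * (w N u - A * coneCoeff s ℓ p N * ρ u ^ y)
              + M * (-(2 * c) * (w N u / ρ u) + 2 * (e * w (N - 1) u)
                + 2 * (2 * m + p) * B * Z) := by
          rw [hy1, hy0, hym]
          have : w N u / ρ u * ρ u = w N u := by field_simp
          have h' : pdu ((Pv M r)^[N + 1] α) (u, v₁) =
            (Λ - 2 * M * c / ρ u) * w N u + 2 * M * e * w (N - 1) u
              - (2 * m * (1 - 2 * M / ρ u) / ρ u - 2 * M * m / ρ u ^ 2) * w (N + 1) u := by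
            linear_combination hequ
          rw [h']
          have h'' : Λ * (w N u - A * coneCoeff s ℓ p N * (ρ u * Z))
              = Λ * w N u - B * (m + p) * (ρ u * Z) := by rw [hBΛ]; ring
          rw [h'']
          field_simp
          ring
        rw [hid]
        have hdiv : |w N u / ρ u| ≤ K₁ * Z := by
          rw [abs_div, abs_of_pos hρp, div_le_iff₀ hρp]
          calc _ ≤ K₁ * ρ u ^ y := hb₁u
            _ = _ := by rw [hy0]; ring
        have hlow : |-(2 * c) * (w N u / ρ u) + 2 * (e * w (N - 1) u)
            + 2 * (2 * m + p) * B * Z|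
            ≤ (2 * |c| * K₁ + 2 * K₂ + |2 * (2 * m + p) * B|) * Z := by
          refine (abs_add_three _ _ _).trans ?_
          rw [abs_mul, abs_mul (2 : ℝ) (e * _), abs_mul _ Z, abs_neg, abs_mul 2 c, abs_two,
            abs_of_nonneg hZ0]
          have t₁ := mul_le_mul_of_nonneg_left hdiv (by positivity : 0 ≤ 2 * |c|)
          linarith
        set Q : ℝ := 2 * |c| * K₁ + 2 * K₂ + |2 * (2 * m + p) * B| with hQ_def
        have hQ0 : 0 ≤ Q := by positivity
        have hY0 : 0 ≤ ρ u ^ (y - ε) := Real.rpow_nonneg hρp.le _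
        refine (abs_add_le _ _).trans ?_
        rw [abs_mul, abs_mul M, abs_of_nonneg hM]
        have t₁ := mul_le_mul_of_nonneg_left h₁u (abs_nonneg Λ)
        have t₂ := mul_le_mul_of_nonneg_left hlow hM
        have t₃ := mul_nonneg hQ0 hY0
        linarith
      obtain ⟨C', hC', hfin⟩ := exists_abs_le_of_transport hM hR hρR hρ hr0 (m := m) (p := p) hε hmp
        (by positivity) hE hres hlim
      refine ⟨C', hC', fun u hu => ?_⟩
      have h := hfin u hu
      push_cast
      rw [hmR] at h
      rw [show (N : ℝ) + 1 + s - p = y + 1 by rw [hy_def]; ring]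
      rwa [show (N : ℝ) + s + 1 - p = y + 1 by rw [hy_def]; ring] at h
  exact fun N hN => main N hN N (by simp)
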